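/- arXiv:1808.06168 — 19 statements merged into one kernel-verified Lean document; each statement's English description precedes it below -/
import Mathlib

section
/- Let f : X → Y and g : Y → Z be continuous maps of topological spaces. If the composite g ∘ f and the map f are both quasi-open, and the image f(X) is dense in Y, then g is quasi-open. -/
/-- A continuous map is *quasi-open* if the image of every nonempty open set
has nonempty interior. -/
def QuasiOpen {X Y : Type*} [TopologicalSpace X] [TopologicalSpace Y] (f : X → Y) : Prop :=
  ∀ U : Set X, IsOpen U → U.Nonempty → (interior (f '' U)).Nonempty

theorem quasiOpen_of_comp {X Y Z : Type*} [TopologicalSpace X] [TopologicalSpace Y]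
    [TopologicalSpace Z] (f : X → Y) (g : Y → Z)
    (hf : Continuous f) (hg : Continuous g)
    (hgf : QuasiOpen (g ∘ f)) (hqf : QuasiOpen f) (hd : Dense (Set.range f)) :
    QuasiOpen g := by
  intro V hV hne
  obtain ⟨y, hyV, x, rfl⟩ := hd.inter_open_nonempty V hV hne
  refine (hgf (f ⁻¹' V) (hV.preimage hf) ⟨x, hyV⟩).mono (interior_mono ?_)
  rintro _ ⟨a, ha, rfl⟩
  exact ⟨f a, ha, rfl⟩
end

section
/- Let X and Y be compact Hausdorff spaces, let EX and EY be extremally disconnected compact Hausdorff spaces, let π_X : EX → X and π_Y : EY → Y be continuous irreducible surjections, and let f : X → Y and f̄ : EX → EY be continuous maps with f ∘ π_X = π_Y ∘ f̄. Then f is quasi-open if and only if f̄ is an open map. -/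
/-- A map is *irreducible* if it is surjective and the image of every proper
closed subset is proper. -/
def IrreducibleMap {X Y : Type*} [TopologicalSpace X] [TopologicalSpace Y] (p : X → Y) : Prop :=
  Function.Surjective p ∧ ∀ F : Set X, IsClosed F → F ≠ Set.univ → p '' F ≠ Set.univ

/-- For an irreducible closed map, every nonempty open set contains a full
preimage of a nonempty open set. -/
lemma irreducible_small_image {E X : Type*} [TopologicalSpace E] [TopologicalSpace X]
    [CompactSpace E] [T2Space X] {p : E → X} (hp : Continuous p) (hi : IrreducibleMap p)
    {U : Set E} (hU : IsOpen U) (hne : U.Nonempty) :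
    ∃ W : Set X, IsOpen W ∧ W.Nonempty ∧ p ⁻¹' W ⊆ U := by
  refine ⟨(p '' Uᶜ)ᶜ, (hp.isClosedMap _ hU.isClosed_compl).isOpen_compl, ?_, ?_⟩
  · rw [Set.nonempty_compl]
    apply hi.2 _ hU.isClosed_compl
    rw [Ne, Set.compl_univ_iff]
    exact hne.ne_empty
  · intro x hx
    by_contra h
    exact hx ⟨x, h, rfl⟩

theorem quasiOpen_iff_lift_isOpenMap
    {X Y EX EY : Type*} [TopologicalSpace X] [TopologicalSpace Y]
    [TopologicalSpace EX] [TopologicalSpace EY]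
    [CompactSpace X] [T2Space X] [CompactSpace Y] [T2Space Y]
    [CompactSpace EX] [T2Space EX] [ExtremallyDisconnected EX]
    [CompactSpace EY] [T2Space EY] [ExtremallyDisconnected EY]
    (πX : EX → X) (πY : EY → Y) (hπX : Continuous πX) (hπY : Continuous πY)
    (hiX : IrreducibleMap πX) (hiY : IrreducibleMap πY)
    (f : X → Y) (fb : EX → EY) (hf : Continuous f) (hfb : Continuous fb)
    (hcomm : f ∘ πX = πY ∘ fb) :
    QuasiOpen f ↔ IsOpenMap fb := by
  have hc : ∀ x, f (πX x) = πY (fb x) := fun x => congrFun hcomm x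
  constructor
  · intro hq
    have key : ∀ U : Set EX, IsClopen U → U.Nonempty → (interior (fb '' U)).Nonempty := by
      intro U hU hne
      obtain ⟨W, hWo, hWne, hWU⟩ := irreducible_small_image hπX hiX hU.isOpen hne
      have hK : IsClosed (fb '' U) := hfb.isClosedMap _ hU.isClosed
      have hGo : IsOpen (πY ⁻¹' interior (f '' W)) := isOpen_interior.preimage hπY
      have hGne : (πY ⁻¹' interior (f '' W)).Nonempty := (hq W hWo hWne).preimage hiY.1
      have hsub : πY ⁻¹' interior (f '' W) ⊆ fb '' U := by
        by_contra hns
        obtain ⟨z, hz, hzK⟩ := Set.not_subset.1 hns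
        obtain ⟨V, -, ⟨y, hy⟩, hV⟩ := irreducible_small_image hπY hiY
          (hGo.inter hK.isOpen_compl) ⟨z, hz, hzK⟩
        obtain ⟨e, rfl⟩ := hiY.1 y
        obtain ⟨w, hw, hwe⟩ := interior_subset (hV hy).1
        obtain ⟨x, rfl⟩ := hiX.1 w
        have h1 : fb x ∈ πY ⁻¹' V := by
          change πY (fb x) ∈ V
          rw [← hc, hwe]
          exact hy
        exact (hV h1).2 ⟨x, hWU hw, rfl⟩
      exact hGne.mono (interior_maximal hsub hGo)
    rw [(isTopologicalBasis_isClopen (X := EX)).isOpenMap_iff]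
    intro U hU
    have hU : IsClopen U := hU
    have hK : IsClosed (fb '' U) := hfb.isClosedMap _ hU.isClosed
    have hcl : IsClopen (closure (interior (fb '' U))) :=
      ⟨isClosed_closure, ExtremallyDisconnected.open_closure _ isOpen_interior⟩
    have heq : fb '' U = closure (interior (fb '' U)) := by
      apply Set.Subset.antisymm _ (closure_minimal interior_subset hK)
      rintro _ ⟨x, hx, rfl⟩
      by_contra hn
      obtain ⟨z, hz⟩ := key (U \ fb ⁻¹' closure (interior (fb '' U)))
        (hU.diff (hcl.preimage hfb)) ⟨x, hx, hn⟩
      obtain ⟨u, hu, rfl⟩ := interior_subset hz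
      exact hu.2 (subset_closure (interior_mono (Set.image_mono Set.diff_subset) hz))
    rw [heq]
    exact hcl.isOpen
  · intro ho U hU hne
    obtain ⟨W, hWo, hWne, hW⟩ := irreducible_small_image hπY hiY
      (ho _ (hU.preimage hπX)) ((hne.preimage hiX.1).image fb)
    refine hWne.mono (interior_maximal ?_ hWo)
    intro y hy
    obtain ⟨e, rfl⟩ := hiY.1 y
    obtain ⟨x, hx, rfl⟩ := hW hy
    exact ⟨πX x, hx, hc x⟩
end

section
/- Let X and Y be compact Hausdorff spaces, let EX and EY be extremally disconnected compact Hausdorff spaces, let π_X : EX → X and π_Y : EY → Y be continuous irreducible surjections, and let f : X → Y be a continuous surjection. Then there exists a unique continuous map f̄ : EX → EY with f ∘ π_X = π_Y ∘ f̄ if and only if for every regular closed set F ⊆ Y one has cl(int(f⁻¹(F))) = cl(f⁻¹(int(F))). -/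
theorem irr_image_subset {E A : Type*} [TopologicalSpace E] [TopologicalSpace A] {p : E → A}
    (hp : Continuous p) (hi : IrreducibleMap p) {G : Set E} (hG : IsOpen G) :
    p '' G ⊆ closure ((p '' Gᶜ)ᶜ) := by
  rintro _ ⟨e, he, rfl⟩
  rw [mem_closure_iff]
  intro N hN heN
  have hO : IsOpen (G ∩ p ⁻¹' N) := hG.inter (hN.preimage hp)
  have hne : (G ∩ p ⁻¹' N)ᶜ ≠ Set.univ := by
    intro h
    have : e ∈ (G ∩ p ⁻¹' N)ᶜ := by rw [h]; trivial
    exact this ⟨he, heN⟩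
  have h2 := hi.2 _ hO.isClosed_compl hne
  obtain ⟨y, hy⟩ := (Set.ne_univ_iff_exists_notMem _).1 h2
  obtain ⟨x, rfl⟩ := hi.1 y
  have hx : x ∈ G ∩ p ⁻¹' N := by
    by_contra h
    exact hy ⟨x, h, rfl⟩
  refine ⟨p x, hx.2, ?_⟩
  rintro ⟨z, hz, hzx⟩
  exact hy ⟨z, fun h => hz h.1, hzx⟩

theorem exists_lift_clopen.{u_1, u_2, u_3} {E : Type u_1} {B : Type u_2} {Y : Type u_3} [TopologicalSpace E]
    [TopologicalSpace B] [TopologicalSpace Y] [CompactSpace E] [T2Space E]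
    [ExtremallyDisconnected E] [CompactSpace B] [T2Space B] [T2Space Y]
    {φ : E → Y} {p : B → Y} (hφ : Continuous φ) (hp : Continuous p)
    (hs : Function.Surjective p) {A : Set E} (hA : IsOpen A) {C : Set B} (hC : IsClosed C)
    (hAC : φ '' A ⊆ p '' C) :
    ∃ g : E → B, Continuous g ∧ φ = p ∘ g ∧ ∀ a ∈ A, g a ∈ C := by
  classical
  let Z : Set (E × B) := {z | φ z.1 = p z.2} ∩ (Prod.fst ⁻¹' Aᶜ ∪ Prod.snd ⁻¹' C)
  have hZ : IsClosed Z := by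
    refine (isClosed_eq (by fun_prop) (by fun_prop)).inter ?_
    exact (hA.isClosed_compl.preimage continuous_fst).union (hC.preimage continuous_snd)
  haveI : CompactSpace Z := isCompact_iff_compactSpace.1 hZ.isCompact
  haveI : ExtremallyDisconnected (ULift.{max u_1 u_2} E) :=
    extremallyDisconnected_of_homeo Homeomorph.ulift.symm
  have hproj : CompactT2.Projective (ULift.{max u_1 u_2} E) :=
    CompactT2.ExtremallyDisconnected.projective
  let q : Z → ULift.{max u_1 u_2} E := fun z => ULift.up z.1.1
  have hq : Continuous q := continuous_uliftUp.comp (by fun_prop)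
  have hqs : Function.Surjective q := by
    rintro ⟨e⟩
    by_cases he : e ∈ A
    · obtain ⟨c, hc, h⟩ := hAC ⟨e, he, rfl⟩
      exact ⟨⟨(e, c), h.symm, Or.inr hc⟩, rfl⟩
    · obtain ⟨c, h⟩ := hs (φ e)
      exact ⟨⟨(e, c), h.symm, Or.inl he⟩, rfl⟩
  obtain ⟨s, hsc, hsq⟩ := hproj continuous_id hq hqs
  have key : ∀ e, (s ⟨e⟩).1.1 = e := fun e => congrArg ULift.down (congrFun hsq ⟨e⟩)
  refine ⟨fun e => (s ⟨e⟩).1.2, ?_, ?_, ?_⟩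
  · exact continuous_snd.comp (continuous_subtype_val.comp (hsc.comp continuous_uliftUp))
  · funext e
    have := (s ⟨e⟩).2.1
    simp only [Set.mem_setOf_eq, key] at this
    exact this
  · intro a ha
    rcases (s ⟨a⟩).2.2 with h | h
    · exact absurd ha (by simpa [key] using h)
    · exact h

theorem existsUnique_lift_iff_regularClosed_condition
    {X Y EX EY : Type*} [TopologicalSpace X] [TopologicalSpace Y]
    [TopologicalSpace EX] [TopologicalSpace EY]
    [CompactSpace X] [T2Space X] [CompactSpace Y] [T2Space Y]
    [CompactSpace EX] [T2Space EX] [ExtremallyDisconnected EX]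
    [CompactSpace EY] [T2Space EY] [ExtremallyDisconnected EY]
    (πX : EX → X) (πY : EY → Y) (hπX : Continuous πX) (hπY : Continuous πY)
    (hiX : IrreducibleMap πX) (hiY : IrreducibleMap πY)
    (f : X → Y) (hf : Continuous f) (hfs : Function.Surjective f) :
    (∃! fb : EX → EY, Continuous fb ∧ f ∘ πX = πY ∘ fb) ↔
      ∀ F : Set Y, F = closure (interior F) →
        closure (interior (f ⁻¹' F)) = closure (f ⁻¹' (interior F)) := by
  have hφ : Continuous (f ∘ πX) := hf.comp hπX
  constructor
  · rintro ⟨g, -, hg⟩ F hF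
    have hFc : IsClosed F := by rw [hF]; exact isClosed_closure
    apply Set.Subset.antisymm _
      (closure_mono (interior_maximal (Set.preimage_mono interior_subset)
        (isOpen_interior.preimage hf)))
    apply closure_minimal _ isClosed_closure
    intro x hx
    by_contra hxn
    let U : Set X := interior (f ⁻¹' F) ∩ (closure (f ⁻¹' (interior F)))ᶜ
    have hU : IsOpen U := isOpen_interior.inter isClosed_closure.isOpen_compl
    let C : Set EY := closure (πY ⁻¹' (interior F))
    have hCo : IsOpen C :=
      ExtremallyDisconnected.open_closure _ (isOpen_interior.preimage hπY)
    have hCF : F ⊆ πY '' C := by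
      rw [hF]
      refine closure_minimal ?_ (isClosed_closure.isCompact.image hπY).isClosed
      intro y hy
      obtain ⟨e, rfl⟩ := hiY.1 y
      exact ⟨e, subset_closure hy, rfl⟩
    have hCF' : ∀ e ∈ C, πY e ∈ F := by
      have : C ⊆ πY ⁻¹' F := closure_minimal (Set.preimage_mono interior_subset)
        (hFc.preimage hπY)
      exact this
    have hCc : (interior F)ᶜ ⊆ πY '' Cᶜ := by
      rw [← closure_compl]
      refine closure_minimal ?_ (hCo.isClosed_compl.isCompact.image hπY).isClosed
      intro y hy
      obtain ⟨e, rfl⟩ := hiY.1 y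
      exact ⟨e, fun h => hy (hCF' e h), rfl⟩
    have hAo : IsOpen (πX ⁻¹' U) := hU.preimage hπX
    obtain ⟨g1, h1, h1', h1C⟩ := exists_lift_clopen hφ hπY hiY.1 hAo
      (C := C) isClosed_closure (by
        rintro _ ⟨e, he, rfl⟩
        exact hCF (interior_subset (s := f ⁻¹' F) he.1))
    obtain ⟨g2, h2, h2', h2C⟩ := exists_lift_clopen hφ hπY hiY.1 hAo
      (C := Cᶜ) hCo.isClosed_compl (by
        rintro _ ⟨e, he, rfl⟩
        exact hCc (fun h => he.2 (subset_closure h)))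
    obtain ⟨e, rfl⟩ := hiX.1 x
    have he : e ∈ πX ⁻¹' U := ⟨hx, hxn⟩
    have h12 : g1 = g2 := (hg g1 ⟨h1, h1'⟩).trans (hg g2 ⟨h2, h2'⟩).symm
    exact h2C e he (h12 ▸ h1C e he)
  · intro H
    obtain ⟨g, hg, hg', -⟩ := exists_lift_clopen hφ hπY hiY.1 (A := ∅) isOpen_empty
      (C := ∅) isClosed_empty (by simp)
    refine ⟨g, ⟨hg, hg'⟩, ?_⟩
    rintro h ⟨hh, hh'⟩
    by_contra hne
    obtain ⟨a, ha⟩ := Function.ne_iff.1 hne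
    obtain ⟨C, hC, haC, haC'⟩ := exists_isClopen_of_totally_separated ha
    let A : Set EX := h ⁻¹' C ∩ g ⁻¹' Cᶜ
    have hA : IsOpen A := (hC.isOpen.preimage hh).inter (hC.compl.isOpen.preimage hg)
    let F : Set Y := πY '' C
    have hFc : IsClosed F := (hC.isClosed.isCompact.image hπY).isClosed
    have hF'c : IsClosed (πY '' Cᶜ) := (hC.compl.isClosed.isCompact.image hπY).isClosed
    have hO : (πY '' Cᶜ)ᶜ ⊆ interior F := by
      refine interior_maximal ?_ hF'c.isOpen_compl
      intro y hy
      obtain ⟨e, rfl⟩ := hiY.1 y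
      by_contra hn
      exact hy ⟨e, fun hc => hn ⟨e, hc, rfl⟩, rfl⟩
    have hF : F = closure (interior F) :=
      ((irr_image_subset hπY hiY hC.isOpen).trans (closure_mono hO)).antisymm
        (closure_minimal interior_subset hFc)
    have hF' : πY '' Cᶜ ⊆ (interior F)ᶜ := by
      have := irr_image_subset hπY hiY hC.compl.isOpen
      rwa [compl_compl, closure_compl] at this
    have hUo : IsOpen (πX '' Aᶜ)ᶜ :=
      (hA.isClosed_compl.isCompact.image hπX).isClosed.isOpen_compl
    have hUA : ∀ x ∈ (πX '' Aᶜ)ᶜ, ∃ e ∈ A, πX e = x := by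
      intro x hx
      obtain ⟨e, rfl⟩ := hiX.1 x
      exact ⟨e, by_contra fun hn => hx ⟨e, hn, rfl⟩, rfl⟩
    have hUF : (πX '' Aᶜ)ᶜ ⊆ interior (f ⁻¹' F) := by
      refine interior_maximal ?_ hUo
      intro x hx
      obtain ⟨e, he, rfl⟩ := hUA x hx
      exact ⟨h e, he.1, (congrFun hh' e).symm⟩
    have hAne : Aᶜ ≠ Set.univ := by
      intro hu
      have : a ∈ Aᶜ := by rw [hu]; trivial
      exact this ⟨haC, haC'⟩
    obtain ⟨x, hx⟩ := (Set.ne_univ_iff_exists_notMem _).1 (hiX.2 _ hA.isClosed_compl hAne)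
    have hxc : x ∈ closure (f ⁻¹' (interior F)) := by
      rw [← H F hF]
      exact subset_closure (hUF hx)
    obtain ⟨z, hz, hzF⟩ := mem_closure_iff.1 hxc _ hUo hx
    obtain ⟨e, he, rfl⟩ := hUA z hz
    exact hF' ⟨g e, he.2, (congrFun hg' e).symm⟩ hzF
end

section
/- Let p : X → Y be a continuous, closed, irreducible map of topological spaces. Then for every regular closed set H ⊆ X the image p(H) is regular closed in Y; the assignment H ↦ p(H) is a bijection from the set of regular closed subsets of X onto the set of regular closed subsets of Y; its inverse sends a regular closed set K ⊆ Y to cl(p⁻¹(int(K))); and both the map and its inverse preserve inclusion (so it is an isomorphism of the Boolean algebras of regular closed sets). -/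
/-- A set is *regular closed* if it equals the closure of its interior. -/
def IsRegClosed {X : Type*} [TopologicalSpace X] (F : Set X) : Prop :=
  F = closure (interior F)

theorem image_regularClosed_boolean_iso {X Y : Type*}
    [TopologicalSpace X] [TopologicalSpace Y]
    (p : X → Y) (hp : Continuous p) (hcl : IsClosedMap p) (hirr : IrreducibleMap p) :
    (∀ H : Set X, IsRegClosed H → IsRegClosed (p '' H)) ∧
    (∀ K : Set Y, IsRegClosed K → ∃! H : Set X, IsRegClosed H ∧ p '' H = K) ∧
    (∀ K : Set Y, IsRegClosed K →
      IsRegClosed (closure (p ⁻¹' (interior K))) ∧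
      p '' closure (p ⁻¹' (interior K)) = K) ∧
    (∀ H₁ H₂ : Set X, IsRegClosed H₁ → IsRegClosed H₂ → (H₁ ⊆ H₂ ↔ p '' H₁ ⊆ p '' H₂)) := by
  obtain ⟨hsurj, hirr⟩ := hirr
  -- every nonempty open set contains a full fiber
  have key : ∀ W : Set X, IsOpen W → W.Nonempty → ∃ y, ∀ x, p x = y → x ∈ W := by
    intro W hW hne
    have h := hirr Wᶜ hW.isClosed_compl (by
      intro h
      obtain ⟨x, hx⟩ := hne
      have : x ∈ Wᶜ := h ▸ Set.mem_univ x
      exact this hx)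
    obtain ⟨y, hy⟩ := (Set.ne_univ_iff_exists_notMem _).1 h
    refine ⟨y, fun x hx => ?_⟩
    by_contra hxW
    exact hy ⟨x, hxW, hx⟩
  have h1 : ∀ H : Set X, IsRegClosed H → IsRegClosed (p '' H) := by
    intro H hH
    have hHc : IsClosed H := by
      rw [hH]; exact isClosed_closure
    have hpc : IsClosed (p '' H) := hcl H hHc
    apply Set.Subset.antisymm
    · have hsub : H ⊆ p ⁻¹' closure (interior (p '' H)) := by
        have hc : IsClosed (p ⁻¹' closure (interior (p '' H))) := isClosed_closure.preimage hp
        have hH' : closure (interior H) ⊆ p ⁻¹' closure (interior (p '' H)) := by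
          apply closure_minimal _ hc
          intro x hx
          refine mem_closure_iff.2 fun V hV hxV => ?_
          obtain ⟨y, hy⟩ := key (interior H ∩ p ⁻¹' V) (isOpen_interior.inter (hV.preimage hp))
            ⟨x, hx, hxV⟩
          have hO : IsOpen (p '' (interior H)ᶜ)ᶜ :=
            (hcl _ isOpen_interior.isClosed_compl).isOpen_compl
          have hOs : (p '' (interior H)ᶜ)ᶜ ⊆ p '' H := by
            intro z hz
            obtain ⟨w, rfl⟩ := hsurj z
            refine ⟨w, interior_subset ?_, rfl⟩
            by_contra hw
            exact hz ⟨w, hw, rfl⟩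
          refine ⟨y, ?_, interior_maximal hOs hO ?_⟩
          · obtain ⟨w, rfl⟩ := hsurj y
            exact (hy w rfl).2
          · rintro ⟨w, hw, hwy⟩
            exact hw (hy w hwy).1
        exact hH.subset.trans hH'
      exact Set.image_subset_iff.2 hsub
    · exact closure_minimal interior_subset hpc
  have h3 : ∀ K : Set Y, IsRegClosed K →
      IsRegClosed (closure (p ⁻¹' (interior K))) ∧
      p '' closure (p ⁻¹' (interior K)) = K := by
    intro K hK
    constructor
    · apply Set.Subset.antisymm
      · exact closure_mono (interior_maximal subset_closure (isOpen_interior.preimage hp))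
      · exact closure_minimal interior_subset isClosed_closure
    · rw [← hcl.closure_image_eq_of_continuous hp, Set.image_preimage_eq _ hsurj]
      exact hK.symm
  have h4 : ∀ H₁ H₂ : Set X, IsRegClosed H₁ → IsRegClosed H₂ →
      (H₁ ⊆ H₂ ↔ p '' H₁ ⊆ p '' H₂) := by
    intro H₁ H₂ hH₁ hH₂
    refine ⟨fun h => Set.image_mono h, fun h => ?_⟩
    have hc : IsClosed H₂ := by
      rw [hH₂]; exact isClosed_closure
    have hs : closure (interior H₁) ⊆ H₂ := by
      refine closure_minimal (fun x hx => ?_) hc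
      by_contra hx2
      obtain ⟨y, hy⟩ := key (interior H₁ ∩ H₂ᶜ) (isOpen_interior.inter hc.isOpen_compl)
        ⟨x, hx, hx2⟩
      obtain ⟨w, rfl⟩ := hsurj y
      obtain ⟨v, hv, hvw⟩ := h ⟨w, interior_subset (hy w rfl).1, rfl⟩
      exact (hy v hvw).2 hv
    exact hH₁.subset.trans hs
  refine ⟨h1, fun K hK => ⟨_, h3 K hK, ?_⟩, h3, h4⟩
  rintro H ⟨hH, hHK⟩
  obtain ⟨hG, hGK⟩ := h3 K hK
  exact Set.Subset.antisymm ((h4 _ _ hH hG).2 (hHK.trans hGK.symm).subset)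
    ((h4 _ _ hG hH).2 (hGK.trans hHK.symm).subset)
end

section
/- A continuous map f : X → Y between extremally disconnected compact Hausdorff spaces is quasi-open if and only if it is an open map. -/
theorem quasiOpen_iff_isOpenMap_of_extremallyDisconnected
    {X Y : Type*} [TopologicalSpace X] [TopologicalSpace Y]
    [CompactSpace X] [T2Space X] [ExtremallyDisconnected X]
    [CompactSpace Y] [T2Space Y] [ExtremallyDisconnected Y]
    (f : X → Y) (hf : Continuous f) :
    QuasiOpen f ↔ IsOpenMap f := by
  constructor
  · intro hq
    have key : ∀ C : Set X, IsOpen C → IsClosed C → IsOpen (f '' C) := by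
      intro C hCo hCc
      have hcl : IsClosed (f '' C) := (hCc.isCompact.image hf).isClosed
      have hsub : closure (interior (f '' C)) ⊆ f '' C :=
        closure_minimal interior_subset hcl
      have hsup : f '' C ⊆ closure (interior (f '' C)) := by
        rintro _ ⟨x, hx, rfl⟩
        by_contra hn
        obtain ⟨y, hy⟩ := hq (C ∩ f ⁻¹' (closure (interior (f '' C)))ᶜ)
          (hCo.inter (isClosed_closure.isOpen_compl.preimage hf)) ⟨x, hx, hn⟩
        have h1 : y ∈ interior (f '' C) :=
          interior_mono (Set.image_mono Set.inter_subset_left) hy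
        obtain ⟨z, ⟨_, hz⟩, rfl⟩ := interior_subset hy
        exact hz (subset_closure h1)
      rw [← hsub.antisymm hsup]
      exact ExtremallyDisconnected.open_closure _ isOpen_interior
    intro U hU
    rw [isOpen_iff_mem_nhds]
    rintro _ ⟨x, hx, rfl⟩
    obtain ⟨K, hK, hKc, hKU⟩ := exists_mem_nhds_isClosed_subset (hU.mem_nhds hx)
    have ho := key (closure (interior K))
      (ExtremallyDisconnected.open_closure _ isOpen_interior) isClosed_closure
    refine Filter.mem_of_superset (ho.mem_nhds
      ⟨x, subset_closure (mem_interior_iff_mem_nhds.2 hK), rfl⟩) (Set.image_mono ?_)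
    exact (closure_minimal interior_subset hKc).trans hKU
  · intro ho U hU hne
    rw [(ho U hU).interior_eq]
    exact hne.image f
end

section
/- Let Y be an extremally disconnected compact Hausdorff space whose clopen subsets form a basis of the topology, let X be a compact Hausdorff space, and let π : Y → X be a continuous irreducible surjection. Define a binary relation C on the clopen subsets of Y by: U C V if and only if π(U) ∩ π(V) ≠ ∅. Then C is a normal contact relation on the Boolean algebra of clopen subsets of Y, i.e., C satisfies axioms (C1)–(C6). -/
open TopologicalSpace

/-- A binary relation on a Boolean algebra is a *normal contact relation*
if it satisfies the axioms (C1)–(C6). -/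
def IsNormalContact {B : Type*} [BooleanAlgebra B] (C : B → B → Prop) : Prop :=
  (∀ a, a ≠ ⊥ → C a a) ∧
  (∀ a b, C a b → a ≠ ⊥ ∧ b ≠ ⊥) ∧
  (∀ a b, C a b → C b a) ∧
  (∀ a b c, C a (b ⊔ c) ↔ C a b ∨ C a c) ∧
  (∀ a b, ¬C a b → ∃ c, ¬C a c ∧ ¬C b cᶜ) ∧
  (∀ a, a ≠ ⊤ → ∃ b, b ≠ ⊥ ∧ ¬C b a)

theorem isNormalContact_of_irreducible
    {Y X : Type*} [TopologicalSpace Y] [TopologicalSpace X]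
    [CompactSpace Y] [T2Space Y] [ExtremallyDisconnected Y]
    [CompactSpace X] [T2Space X]
    (hbasis : IsTopologicalBasis {U : Set Y | IsClopen U})
    (π : Y → X) (hπ : Continuous π) (hirr : IrreducibleMap π) :
    IsNormalContact (fun U V : Clopens Y => (π '' (U : Set Y) ∩ π '' (V : Set Y)).Nonempty) := by
  have hcl : ∀ U : Clopens Y, IsClosed (π '' (U : Set Y)) := fun U =>
    (U.isClopen.isClosed.isCompact.image hπ).isClosed
  refine ⟨?_, ?_, ?_, ?_, ?_, ?_⟩
  · intro a ha
    have : (a : Set Y).Nonempty := by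
      rw [Set.nonempty_iff_ne_empty]
      intro h
      exact ha (SetLike.coe_injective (by simpa using h))
    obtain ⟨y, hy⟩ := this
    exact ⟨π y, ⟨y, hy, rfl⟩, ⟨y, hy, rfl⟩⟩
  · rintro a b ⟨x, ⟨y, hy, -⟩, ⟨z, hz, -⟩⟩
    constructor
    · rintro rfl
      simp at hy
    · rintro rfl
      simp at hz
  · rintro a b ⟨x, h1, h2⟩
    exact ⟨x, h2, h1⟩
  · intro a b c
    simp only [Clopens.coe_sup, Set.image_union, Set.inter_union_distrib_left, Set.union_nonempty]
  · intro a b hab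
    have hd : Disjoint (π '' (a : Set Y)) (π '' (b : Set Y)) := by
      rw [Set.disjoint_iff_inter_eq_empty]
      exact Set.not_nonempty_iff_eq_empty.mp hab
    obtain ⟨O₁, O₂, h1, h2, ha, hb, hO⟩ := normal_separation (hcl a) (hcl b) hd
    have hsub : closure (π ⁻¹' O₂) ⊆ π ⁻¹' O₁ᶜ :=
      closure_minimal (fun y hy h => Set.disjoint_left.mp hO h hy) (h1.isClosed_compl.preimage hπ)
    refine ⟨⟨closure (π ⁻¹' O₂), isClosed_closure,
      ExtremallyDisconnected.open_closure _ (h2.preimage hπ)⟩, ?_, ?_⟩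
    · rintro ⟨x, hx, ⟨y, hy, rfl⟩⟩
      exact hsub hy (ha hx)
    · rintro ⟨x, hx, ⟨y, hy, rfl⟩⟩
      exact hy (subset_closure (hb hx))
  · intro a ha
    have hne : (a : Set Y) ≠ Set.univ := fun h =>
      ha (SetLike.coe_injective (by simpa using h))
    obtain ⟨x, hx⟩ := (Set.ne_univ_iff_exists_notMem _).mp (hirr.2 _ a.isClopen.isClosed hne)
    obtain ⟨y, rfl⟩ := hirr.1 x
    obtain ⟨b, hb, hyb, hbs⟩ := hbasis.exists_subset_of_mem_open
      (show y ∈ π ⁻¹' (π '' (a : Set Y))ᶜ from hx) ((hcl a).isOpen_compl.preimage hπ)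
    refine ⟨⟨b, hb⟩, ?_, ?_⟩
    · intro h
      have : y ∈ (⟨b, hb⟩ : Clopens Y) := hyb
      rw [h] at this
      exact this
    · rintro ⟨x, ⟨z, hz, rfl⟩, hx'⟩
      exact hbs hz hx'
end

section
/- Let X be an extremally disconnected compact Hausdorff space whose clopen subsets form a basis of the topology, and let C be a normal contact relation on the Boolean algebra of clopen subsets of X. Define a relation R on X by: x R y if and only if U C V for all clopen sets U ∋ x and V ∋ y. Then R is an equivalence relation, R is a closed subset of X × X, the quotient space X/R is a compact Hausdorff space, and the quotient map X → X/R is irreducible. -/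
open TopologicalSpace

/-- The relation on points induced by a contact relation on clopen sets:
`x R y` iff every clopen neighbourhood of `x` is in contact with every clopen
neighbourhood of `y`. -/
def contactRel {X : Type*} [TopologicalSpace X]
    (C : Clopens X → Clopens X → Prop) (x y : X) : Prop :=
  ∀ U V : Clopens X, x ∈ U → y ∈ V → C U V

theorem contactRel_quotient_compact_T2_irreducible
    {X : Type*} [TopologicalSpace X] [CompactSpace X] [T2Space X]
    [ExtremallyDisconnected X]
    (hbasis : IsTopologicalBasis {U : Set X | IsClopen U})
    (C : Clopens X → Clopens X → Prop) (hC : IsNormalContact C) :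
    Equivalence (contactRel C) ∧
    IsClosed {p : X × X | contactRel C p.1 p.2} ∧
    CompactSpace (Quot (contactRel C)) ∧
    T2Space (Quot (contactRel C)) ∧
    IrreducibleMap (Quot.mk (contactRel C)) := by
  obtain ⟨h1, h2, h3, h4, h5, h6⟩ := hC
  have mono : ∀ a b c : Clopens X, C a b → b ≤ c → C a c := by
    intro a b c h hbc
    have := (h4 a b c).2 (Or.inl h)
    rwa [sup_eq_right.2 hbc] at this
  have heq : Equivalence (contactRel C) := by
    refine ⟨?_, ?_, ?_⟩
    · intro x U V hU hV
      have hne : U ⊓ V ≠ ⊥ := by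
        intro h
        have hx : x ∈ U ⊓ V := ⟨hU, hV⟩
        rw [h] at hx
        exact hx
      exact mono _ _ _ (h3 _ _ (mono _ _ _ (h1 _ hne) inf_le_left)) inf_le_right
    · intro x y h U V hU hV
      exact h3 _ _ (h V U hV hU)
    · intro x y z hxy hyz U V hU hV
      by_contra hn
      obtain ⟨c, hc1, hc2⟩ := h5 _ _ hn
      by_cases hy : y ∈ c
      · exact hc1 (hxy U c hU hy)
      · exact hc2 (h3 _ _ (hyz cᶜ V hy hV))
  have hcl : IsClosed {p : X × X | contactRel C p.1 p.2} := by
    rw [← isOpen_compl_iff, isOpen_iff_forall_mem_open]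
    rintro ⟨x, y⟩ hxy
    have hxy' : ¬ contactRel C x y := hxy
    unfold contactRel at hxy'
    push Not at hxy'
    obtain ⟨U, V, hU, hV, hn⟩ := hxy'
    refine ⟨(U : Set X) ×ˢ (V : Set X), ?_, U.isClopen.isOpen.prod V.isClopen.isOpen, hU, hV⟩
    rintro ⟨a, b⟩ ⟨ha, hb⟩ hab
    exact hn (hab U V ha hb)
  have hmk : ∀ x y : X, Quot.mk (contactRel C) x = Quot.mk (contactRel C) y ↔ contactRel C x y :=
    fun x y => heq.quot_mk_eq_iff x y
  have hq : Topology.IsQuotientMap (Quot.mk (contactRel C)) := isQuotientMap_quot_mk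
  have hcm : IsClosedMap (Quot.mk (contactRel C)) := by
    intro F hF
    rw [← hq.isClosed_preimage]
    have : Quot.mk (contactRel C) ⁻¹' (Quot.mk (contactRel C) '' F) =
        Prod.snd '' ({p : X × X | contactRel C p.1 p.2} ∩ Prod.fst ⁻¹' F) := by
      ext y
      constructor
      · rintro ⟨x, hx, hxy⟩
        exact ⟨(x, y), ⟨(hmk x y).1 hxy, hx⟩, rfl⟩
      · rintro ⟨⟨x, y'⟩, ⟨hxy, hx⟩, rfl⟩
        exact ⟨x, hx, (hmk x y').2 hxy⟩
    rw [this]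
    exact ((hcl.inter (hF.preimage continuous_fst)).isCompact.image continuous_snd).isClosed
  refine ⟨heq, hcl, inferInstance, ?_, Quot.mk_surjective, ?_⟩
  · have hT1 : ∀ q : Quot (contactRel C), IsClosed ({q} : Set (Quot (contactRel C))) := by
      intro q
      obtain ⟨x, rfl⟩ := Quot.mk_surjective q
      simpa using hcm {x} isClosed_singleton
    refine ⟨fun p q hpq => ?_⟩
    obtain ⟨U, V, hU, hV, hpU, hqV, hd⟩ := normal_separation
      ((hT1 p).preimage hq.continuous) ((hT1 q).preimage hq.continuous)
      (Disjoint.preimage _ (Set.disjoint_singleton.2 hpq))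
    refine ⟨(Quot.mk (contactRel C) '' Uᶜ)ᶜ, (Quot.mk (contactRel C) '' Vᶜ)ᶜ,
      (hcm _ hU.isClosed_compl).isOpen_compl, (hcm _ hV.isClosed_compl).isOpen_compl, ?_, ?_, ?_⟩
    · rintro ⟨x, hx, rfl⟩
      exact hx (hpU rfl)
    · rintro ⟨x, hx, rfl⟩
      exact hx (hqV rfl)
    · rw [Set.disjoint_left]
      intro r hr1 hr2
      obtain ⟨x, rfl⟩ := Quot.mk_surjective r
      have hxU : x ∈ U := by
        by_contra h
        exact hr1 ⟨x, h, rfl⟩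
      have hxV : x ∈ V := by
        by_contra h
        exact hr2 ⟨x, h, rfl⟩
      exact Set.disjoint_left.1 hd hxU hxV
  · intro F hF hne himg
    obtain ⟨w, hw⟩ := (Set.ne_univ_iff_exists_notMem F).1 hne
    obtain ⟨W, hWc, hwW, hWF⟩ := hbasis.exists_subset_of_mem_open
      (show w ∈ Fᶜ from hw) hF.isOpen_compl
    let a : Clopens X := ⟨Wᶜ, IsClopen.compl hWc⟩
    have ha : a ≠ ⊤ := by
      intro h
      have hwa : w ∈ a := by
        rw [h]
        trivial
      exact hwa hwW
    obtain ⟨b, hb, hba⟩ := h6 a ha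
    have : ∃ x, x ∈ b := by
      by_contra hx
      push Not at hx
      apply hb
      ext x
      exact ⟨fun h => (hx x h).elim, fun h => h.elim⟩
    obtain ⟨x, hx⟩ := this
    have hxi : Quot.mk (contactRel C) x ∈ Quot.mk (contactRel C) '' F := by
      rw [himg]
      trivial
    obtain ⟨f, hf, hfx⟩ := hxi
    exact hba ((hmk x f).1 hfx.symm b a hx (fun h => hWF h hf))
end

section
/- Let X be an extremally disconnected compact Hausdorff space whose clopen subsets form a basis of the topology, and let C be a normal contact relation on the Boolean algebra of clopen subsets of X; define R_C on X by x R_C y if and only if U C V for all clopen sets U ∋ x and V ∋ y. Then for all clopen sets U, V ⊆ X: U C V if and only if there exist x ∈ U and y ∈ V with x R_C y. -/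
open TopologicalSpace

theorem exists_point_of_grill {X : Type*} [TopologicalSpace X] [CompactSpace X]
    (D : Clopens X → Prop) (h0 : ¬ D ⊥) (hsup : ∀ a b, D (a ⊔ b) → D a ∨ D b)
    (hmono : ∀ a b, a ≤ b → D a → D b) (V : Clopens X) (hV : D V) :
    ∃ y ∈ V, ∀ W : Clopens X, y ∈ W → D W := by
  by_contra hcon
  push Not at hcon
  have key : ∃ W : Clopens X, (V : Set X) ⊆ W ∧ ¬ D W := by
    refine IsCompact.induction_on (p := fun s => ∃ W : Clopens X, s ⊆ (W : Set X) ∧ ¬ D W)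
      V.isClopen.isClosed.isCompact ⟨⊥, Set.empty_subset _, h0⟩ ?_ ?_ ?_
    · rintro s t hst ⟨W, hW, hD⟩
      exact ⟨W, hst.trans hW, hD⟩
    · rintro s t ⟨W, hW, hD⟩ ⟨W', hW', hD'⟩
      refine ⟨W ⊔ W', ?_, fun h => (hsup _ _ h).elim hD hD'⟩
      rw [Clopens.coe_sup]
      exact Set.union_subset_union hW hW'
    · intro x hx
      obtain ⟨W, hxW, hD⟩ := hcon x hx
      exact ⟨W, mem_nhdsWithin_of_mem_nhds (W.isClopen.isOpen.mem_nhds hxW), W, subset_rfl, hD⟩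
  obtain ⟨W, hW, hD⟩ := key
  exact hD (hmono V W hW hV)

theorem contact_iff_exists_contactRel
    {X : Type*} [TopologicalSpace X] [CompactSpace X] [T2Space X]
    [ExtremallyDisconnected X]
    (hbasis : IsTopologicalBasis {U : Set X | IsClopen U})
    (C : Clopens X → Clopens X → Prop) (hC : IsNormalContact C) :
    ∀ U V : Clopens X, C U V ↔ ∃ x ∈ U, ∃ y ∈ V, contactRel C x y := by
  obtain ⟨-, h2, h3, h4, -, -⟩ := hC
  have mr : ∀ a b c, b ≤ c → C a b → C a c := fun a b c hbc h => by
    have := (h4 a b c).2 (Or.inl h)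
    rwa [sup_eq_right.2 hbc] at this
  have ml : ∀ a b c, b ≤ c → C b a → C c a := fun a b c hbc h =>
    h3 _ _ (mr a b c hbc (h3 _ _ h))
  intro U V
  constructor
  · intro hUV
    obtain ⟨y, hy, hyW⟩ := exists_point_of_grill (fun W => C U W)
      (fun h => (h2 _ _ h).2 rfl) (fun a b h => (h4 U a b).1 h) (mr U) V hUV
    obtain ⟨x, hx, hxW⟩ := exists_point_of_grill (fun A => ∀ W : Clopens X, y ∈ W → C A W)
      (fun h => (h2 _ _ (h V hy)).1 rfl)
      (by
        intro a b h
        by_contra hcon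
        push Not at hcon
        obtain ⟨⟨W, hW, hn⟩, W', hW', hn'⟩ := hcon
        have := h (W ⊓ W') ⟨hW, hW'⟩
        rcases (h4 _ _ _).1 (h3 _ _ this) with h | h
        · exact hn (mr _ _ _ inf_le_left (h3 _ _ h))
        · exact hn' (mr _ _ _ inf_le_right (h3 _ _ h)))
      (fun a b hab h W hW => ml _ _ _ hab (h W hW)) U hyW
    exact ⟨x, hx, y, hy, fun A B hA hB => hxW A hA B hB⟩
  · rintro ⟨x, hx, y, hy, h⟩
    exact h U V hx hy
end

section
/- Let X be an extremally disconnected compact Hausdorff space whose clopen subsets form a basis of the topology, and let R be an equivalence relation on X that is closed as a subset of X × X and such that the quotient map X → X/R is irreducible. Define a relation C_R on clopen subsets of X by: U C_R V if and only if there exist x ∈ U and y ∈ V with x R y. Then C_R is a normal contact relation on the Boolean algebra of clopen subsets of X, and for all x, y ∈ X: x R y if and only if for all clopen sets U ∋ x and V ∋ y there exist x' ∈ U and y' ∈ V with x' R y'. -/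
open TopologicalSpace

theorem isClosed_saturation
    {X : Type*} [TopologicalSpace X] [CompactSpace X]
    (R : X → X → Prop) (hclosed : IsClosed {p : X × X | R p.1 p.2})
    (F : Set X) (hF : IsClosed F) : IsClosed {y : X | ∃ x ∈ F, R x y} := by
  have h : IsClosed ({p : X × X | R p.1 p.2} ∩ Prod.fst ⁻¹' F) :=
    hclosed.inter (hF.preimage continuous_fst)
  have h2 := isClosedMap_snd_of_compactSpace _ h
  convert h2 using 1
  ext y
  constructor
  · rintro ⟨x, hx, hxy⟩
    exact ⟨(x, y), ⟨hxy, hx⟩, rfl⟩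
  · rintro ⟨⟨x, z⟩, ⟨hxy, hx⟩, rfl⟩
    exact ⟨x, hx, hxy⟩

theorem isNormalContact_of_closed_irreducible_equivalence
    {X : Type*} [TopologicalSpace X] [CompactSpace X] [T2Space X]
    [ExtremallyDisconnected X]
    (hbasis : IsTopologicalBasis {U : Set X | IsClopen U})
    (R : X → X → Prop) (hequiv : Equivalence R)
    (hclosed : IsClosed {p : X × X | R p.1 p.2})
    (hirr : IrreducibleMap (Quot.mk R)) :
    IsNormalContact (fun U V : Clopens X => ∃ x ∈ U, ∃ y ∈ V, R x y) ∧
    (∀ x y : X, R x y ↔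
      ∀ U V : Clopens X, x ∈ U → y ∈ V → ∃ x' ∈ U, ∃ y' ∈ V, R x' y') := by
  have hsat := isClosed_saturation R hclosed
  refine ⟨⟨?_, ?_, ?_, ?_, ?_, ?_⟩, ?_⟩
  · intro a ha
    have hne : (a : Set X).Nonempty := by
      rw [Set.nonempty_iff_ne_empty]
      intro h
      exact ha (SetLike.coe_injective h)
    obtain ⟨x, hx⟩ := hne
    exact ⟨x, hx, x, hx, hequiv.refl x⟩
  · rintro a b ⟨x, hx, y, hy, -⟩
    constructor
    · rintro rfl
      exact hx
    · rintro rfl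
      exact hy
  · rintro a b ⟨x, hx, y, hy, h⟩
    exact ⟨y, hy, x, hx, hequiv.symm h⟩
  · intro a b c
    constructor
    · rintro ⟨x, hx, y, hy | hy, h⟩
      · exact Or.inl ⟨x, hx, y, hy, h⟩
      · exact Or.inr ⟨x, hx, y, hy, h⟩
    · rintro (⟨x, hx, y, hy, h⟩ | ⟨x, hx, y, hy, h⟩)
      · exact ⟨x, hx, y, Or.inl hy, h⟩
      · exact ⟨x, hx, y, Or.inr hy, h⟩
  · intro a b hab
    have hd : Disjoint {y : X | ∃ x ∈ (b : Set X), R x y} {y : X | ∃ x ∈ (a : Set X), R x y} := by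
      rw [Set.disjoint_left]
      rintro z ⟨y, hy, hyz⟩ ⟨x, hx, hxz⟩
      exact hab ⟨x, hx, y, hy, hequiv.trans hxz (hequiv.symm hyz)⟩
    obtain ⟨U, V, hU, hV, hbU, haV, hUV⟩ :=
      normal_separation (hsat b b.isClopen.1) (hsat a a.isClopen.1) hd
    have hUV' := hUV.closure_left hV
    refine ⟨⟨closure U, isClosed_closure, ExtremallyDisconnected.open_closure U hU⟩, ?_, ?_⟩
    · rintro ⟨x, hx, y, hy, h⟩
      exact Set.disjoint_left.1 hUV' hy (haV ⟨x, hx, h⟩)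
    · rintro ⟨x, hx, y, hy, h⟩
      exact hy (subset_closure (hbU ⟨x, hx, h⟩))
  · intro a ha
    have hne : (a : Set X) ≠ Set.univ := fun h => ha (SetLike.coe_injective h)
    obtain ⟨q, hq⟩ := (Set.ne_univ_iff_exists_notMem _).1 (hirr.2 a a.isClopen.1 hne)
    obtain ⟨z, rfl⟩ := hirr.1 q
    have hz : z ∈ {y : X | ∃ x ∈ (a : Set X), R x y}ᶜ := by
      rintro ⟨x, hx, h⟩
      exact hq ⟨x, hx, Quot.sound h⟩
    obtain ⟨W, hW, hzW, hWs⟩ :=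
      hbasis.exists_subset_of_mem_open hz (hsat a a.isClopen.1).isOpen_compl
    refine ⟨⟨W, hW⟩, ?_, ?_⟩
    · intro h
      have : z ∈ (⊥ : Clopens X) := h ▸ hzW
      exact this
    · rintro ⟨x, hx, y, hy, h⟩
      exact hWs hx ⟨y, hy, hequiv.symm h⟩
  · intro x y
    constructor
    · intro h U V hx hy
      exact ⟨x, hx, y, hy, h⟩
    · intro h
      by_contra hn
      obtain ⟨u, v, hu, hv, hxu, hyv, huv⟩ :=
        isOpen_prod_iff.1 hclosed.isOpen_compl x y hn
      obtain ⟨U, hU, hxU, hUu⟩ := hbasis.exists_subset_of_mem_open hxu hu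
      obtain ⟨V, hV, hyV, hVv⟩ := hbasis.exists_subset_of_mem_open hyv hv
      obtain ⟨x', hx', y', hy', h'⟩ := h ⟨U, hU⟩ ⟨V, hV⟩ hxU hyV
      exact huv (Set.mk_mem_prod (hUu hx') (hVv hy')) h'
end

section
/- Let X and X' be extremally disconnected compact Hausdorff spaces whose clopen subsets form bases of their topologies, let C and C' be normal contact relations on the Boolean algebras of clopen subsets of X and X' respectively, and let g : X' → X be a continuous map, inducing the Boolean homomorphism ψ on clopen sets given by ψ(U) = g⁻¹(U). Define R_C on X by x R_C y if and only if U C V for all clopen sets U ∋ x and V ∋ y, and define R_{C'} on X' analogously from C'. Then the following are equivalent: (1) for all clopen sets U, V ⊆ X, if ψ(U) C' ψ(V) then U C V; (2) for all x', y' ∈ X', if x' R_{C'} y' then g(x') R_C g(y'). -/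
open TopologicalSpace

theorem clopen_local_to_global {X : Type*} [TopologicalSpace X] [CompactSpace X]
    (P : Clopens X → Prop) (hbot : P ⊥) (hmono : ∀ a b, a ≤ b → P b → P a)
    (hsup : ∀ a b, P a → P b → P (a ⊔ b)) (U : Clopens X)
    (h : ∀ x ∈ U, ∃ W : Clopens X, x ∈ W ∧ P W) : P U := by
  have hU : IsCompact (U : Set X) := U.isClopen.isClosed.isCompact
  have key : ∃ W : Clopens X, (U : Set X) ⊆ W ∧ P W := by
    refine hU.induction_on (p := fun s => ∃ W : Clopens X, s ⊆ (W : Set X) ∧ P W) ?_ ?_ ?_ ?_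
    · exact ⟨⊥, Set.empty_subset _, hbot⟩
    · rintro s t hst ⟨W, hW, hP⟩
      exact ⟨W, hst.trans hW, hP⟩
    · rintro s t ⟨W, hW, hP⟩ ⟨Z, hZ, hQ⟩
      refine ⟨W ⊔ Z, ?_, hsup _ _ hP hQ⟩
      rw [Clopens.coe_sup]
      exact Set.union_subset_union hW hZ
    · intro x hx
      obtain ⟨W, hxW, hP⟩ := h x hx
      exact ⟨W, mem_nhdsWithin_of_mem_nhds (W.isClopen.isOpen.mem_nhds hxW), W,
        subset_rfl, hP⟩
  obtain ⟨W, hW, hP⟩ := key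
  exact hmono _ _ hW hP

theorem exists_contactRel {X : Type*} [TopologicalSpace X] [CompactSpace X]
    (C : Clopens X → Clopens X → Prop) (hC : IsNormalContact C) (U V : Clopens X)
    (h : C U V) : ∃ x ∈ U, ∃ y ∈ V, contactRel C x y := by
  obtain ⟨-, h2, h3, h4, -, -⟩ := hC
  have monoR : ∀ a b c, b ≤ c → C a b → C a c := by
    intro a b c hbc hab
    rw [← sup_eq_right.mpr hbc]
    exact (h4 _ _ _).2 (Or.inl hab)
  have monoL : ∀ a b c, b ≤ c → C b a → C c a := fun a b c hbc hab =>
    h3 _ _ (monoR _ _ _ hbc (h3 _ _ hab))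
  have s1 : ∃ x ∈ U, ∀ W : Clopens X, x ∈ W → C W V := by
    by_contra hcon
    push Not at hcon
    refine clopen_local_to_global (fun W => ¬ C W V) (fun hh => (h2 _ _ hh).1 rfl)
      (fun a b hab hb ha => hb (monoL _ _ _ hab ha)) ?_ U hcon h
    intro a b ha hb hab
    rcases (h4 _ _ _).1 (h3 _ _ hab) with hh | hh
    · exact ha (h3 _ _ hh)
    · exact hb (h3 _ _ hh)
  obtain ⟨x, hxU, hx⟩ := s1
  refine ⟨x, hxU, ?_⟩
  by_contra hcon
  have hfin : ∃ W : Clopens X, x ∈ W ∧ ¬ C W V := by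
    refine clopen_local_to_global (fun Z => ∃ W : Clopens X, x ∈ W ∧ ¬ C W Z) ?_ ?_ ?_ V ?_
    · exact ⟨U, hxU, fun hh => (h2 _ _ hh).2 rfl⟩
    · rintro a b hab ⟨W, hW, hn⟩
      exact ⟨W, hW, fun hh => hn (monoR _ _ _ hab hh)⟩
    · rintro a b ⟨W, hW, hn⟩ ⟨Z, hZ, hm⟩
      refine ⟨W ⊓ Z, ⟨hW, hZ⟩, fun hh => ?_⟩
      rcases (h4 _ _ _).1 hh with hh | hh
      · exact hn (monoL _ _ _ inf_le_left hh)
      · exact hm (monoL _ _ _ inf_le_right hh)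
    · intro y hy
      by_contra hno
      refine hcon ⟨y, hy, fun W Z hW hZ => ?_⟩
      by_contra hn
      exact hno ⟨Z, hZ, W, hW, hn⟩
  obtain ⟨W, hW, hn⟩ := hfin
  exact hn (hx W hW)

theorem reflects_contact_iff_preserves_contactRel
    {X X' : Type*} [TopologicalSpace X] [TopologicalSpace X']
    [CompactSpace X] [T2Space X] [ExtremallyDisconnected X]
    [CompactSpace X'] [T2Space X'] [ExtremallyDisconnected X']
    (hbasis : IsTopologicalBasis {U : Set X | IsClopen U})
    (hbasis' : IsTopologicalBasis {U : Set X' | IsClopen U})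
    (C : Clopens X → Clopens X → Prop) (hC : IsNormalContact C)
    (C' : Clopens X' → Clopens X' → Prop) (hC' : IsNormalContact C')
    (g : X' → X) (hg : Continuous g) :
    ((∀ U V : Clopens X,
        C' ⟨g ⁻¹' (U : Set X), U.isClopen.preimage hg⟩
           ⟨g ⁻¹' (V : Set X), V.isClopen.preimage hg⟩ → C U V) ↔
      (∀ x' y' : X', contactRel C' x' y' → contactRel C (g x') (g y'))) := by
  constructor
  · intro h x y hxy U V hU hV
    exact h U V (hxy _ _ hU hV)
  · intro h U V hUV
    obtain ⟨x, hx, y, hy, hxy⟩ := exists_contactRel C' hC' _ _ hUV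
    exact h x y hxy U V hx hy
end

section
/- Let X be an extremally disconnected compact Hausdorff space whose clopen subsets form a basis of the topology, let C be a normal contact relation on the Boolean algebra of clopen subsets of X, and for x ∈ X set σ_x = { U clopen | U C V for every clopen V with x ∈ V }. Then: (a) σ_x is a cluster of (Clopens(X), C) for every x ∈ X; (b) every cluster of (Clopens(X), C) equals σ_x for some x ∈ X; (c) σ_x = σ_y if and only if U C V for all clopen sets U ∋ x and V ∋ y. -/
open TopologicalSpace

/-- A *cluster* of a contact algebra `(B, C)`. -/
def IsCluster {B : Type*} [BooleanAlgebra B] (C : B → B → Prop) (σ : Set B) : Prop :=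
  σ.Nonempty ∧
  (∀ a ∈ σ, ∀ b ∈ σ, C a b) ∧
  (∀ a b, a ⊔ b ∈ σ → a ∈ σ ∨ b ∈ σ) ∧
  (∀ a, (∀ b ∈ σ, C a b) → a ∈ σ)

theorem clusters_are_point_clusters
    {X : Type*} [TopologicalSpace X] [CompactSpace X] [T2Space X]
    [ExtremallyDisconnected X]
    (hbasis : IsTopologicalBasis {U : Set X | IsClopen U})
    (C : Clopens X → Clopens X → Prop) (hC : IsNormalContact C) :
    (∀ x : X, IsCluster C {U : Clopens X | ∀ V : Clopens X, x ∈ V → C U V}) ∧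
    (∀ σ : Set (Clopens X), IsCluster C σ →
      ∃ x : X, σ = {U : Clopens X | ∀ V : Clopens X, x ∈ V → C U V}) ∧
    (∀ x y : X,
      ({U : Clopens X | ∀ V : Clopens X, x ∈ V → C U V} =
        {U : Clopens X | ∀ V : Clopens X, y ∈ V → C U V}) ↔
      (∀ U V : Clopens X, x ∈ U → y ∈ V → C U V)) := by
  obtain ⟨h1, h2, h3, h4, h5, -⟩ := hC
  have hmono : ∀ a b c : Clopens X, C a b → b ≤ c → C a c := by
    intro a b c hab hbc
    have := (h4 a b c).2 (Or.inl hab)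
    rwa [sup_eq_right.2 hbc] at this
  have hov : ∀ (x : X) (U V : Clopens X), x ∈ U → x ∈ V → C U V := by
    intro x U V hU hV
    have hne : U ⊓ V ≠ ⊥ := by
      intro h
      have hx : x ∈ ((U ⊓ V : Clopens X) : Set X) := ⟨hU, hV⟩
      rw [h] at hx
      exact hx
    have k1 := hmono _ _ U (h1 _ hne) inf_le_left
    exact hmono _ _ V (h3 _ _ k1) inf_le_right
  have ha : ∀ x : X, IsCluster C {U : Clopens X | ∀ V : Clopens X, x ∈ V → C U V} := by
    intro x
    refine ⟨⟨⊤, fun V hV => hov x _ _ (Set.mem_univ x) hV⟩, ?_, ?_, ?_⟩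
    · intro a ha b hb
      by_contra hab
      obtain ⟨c, hac, hbc⟩ := h5 a b hab
      by_cases hx : x ∈ c
      · exact hac (ha c hx)
      · exact hbc (hb cᶜ hx)
    · intro a b hab
      by_contra! h
      obtain ⟨k1, k2⟩ := h
      simp only [Set.mem_ofPred_eq, not_forall] at k1 k2
      obtain ⟨V, hV, hV'⟩ := k1
      obtain ⟨W, hW, hW'⟩ := k2
      have := h3 _ _ (hab (V ⊓ W) ⟨hV, hW⟩)
      rcases (h4 _ _ _).1 this with h | h
      · exact hV' (hmono _ _ _ (h3 _ _ h) inf_le_left)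
      · exact hW' (hmono _ _ _ (h3 _ _ h) inf_le_right)
    · intro a h V hV
      exact h V (fun W hW => hov x _ _ hV hW)
  refine ⟨ha, ?_, ?_⟩
  · intro σ ⟨_, s1, s2, s3⟩
    have htop : (⊤ : Clopens X) ∈ σ :=
      s3 _ (fun b hb => h3 _ _ (hmono _ _ _ (s1 b hb b hb) le_top))
    have hbot : (⊥ : Clopens X) ∉ σ := fun h => (h2 _ _ (s1 _ h _ h)).1 rfl
    have hx : ∃ x : X, ∀ V : Clopens X, x ∈ V → V ∈ σ := by
      by_contra! hcon
      have key : ∃ V : Clopens X, (Set.univ : Set X) ⊆ (V : Set X) ∧ V ∉ σ := by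
        refine isCompact_univ.induction_on (p := fun s : Set X => ∃ V : Clopens X, s ⊆ (V : Set X) ∧ V ∉ σ)
          ⟨⊥, Set.empty_subset _, hbot⟩ ?_ ?_ ?_
        · rintro s t hst ⟨V, hV, hV'⟩
          exact ⟨V, hst.trans hV, hV'⟩
        · rintro s t ⟨V, hV, hV'⟩ ⟨W, hW, hW'⟩
          exact ⟨V ⊔ W, Set.union_subset_union hV hW, fun h => (s2 _ _ h).elim hV' hW'⟩
        · intro x _
          obtain ⟨V, hV, hV'⟩ := hcon x
          exact ⟨V, mem_nhdsWithin_of_mem_nhds (V.isOpen.mem_nhds hV), V, subset_rfl, hV'⟩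
      obtain ⟨V, hV, hV'⟩ := key
      have : V = ⊤ := top_le_iff.1 hV
      exact hV' (this ▸ htop)
    obtain ⟨x, hx⟩ := hx
    have hsub : σ ⊆ {U : Clopens X | ∀ V : Clopens X, x ∈ V → C U V} :=
      fun U hU V hV => s1 U hU V (hx V hV)
    exact ⟨x, hsub.antisymm fun U hU => s3 U fun b hb => (ha x).2.1 U hU b (hsub hb)⟩
  · intro x y
    constructor
    · intro h U V hU hV
      have : U ∈ {U : Clopens X | ∀ V : Clopens X, x ∈ V → C U V} :=
        fun W hW => hov x _ _ hU hW
      rw [h] at this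
      exact this V hV
    · intro h
      apply Set.Subset.antisymm
      · intro U hU V hV
        exact (ha x).2.1 U hU V (fun W hW => h3 _ _ (h W V hW hV))
      · intro U hU V hV
        exact (ha y).2.1 U hU V (fun W hW => h V W hV hW)
end

section
/- Let (B, C) be a normal contact algebra. A subset σ ⊆ B is a cluster if and only if there exists an ultrafilter u of B such that σ = { a ∈ B | a C b for every b ∈ u }. Moreover, for every cluster σ and every a₀ ∈ σ, the ultrafilter u can be chosen so that additionally a₀ ∈ u. -/
/-- An ultrafilter of a Boolean algebra, as a set of elements. -/
def IsBoolUltrafilter {B : Type*} [BooleanAlgebra B] (u : Set B) : Prop :=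
  (⊥ : B) ∉ u ∧
  (∀ a ∈ u, ∀ b ∈ u, a ⊓ b ∈ u) ∧
  (∀ a ∈ u, ∀ b, a ≤ b → b ∈ u) ∧
  (∀ a : B, a ∈ u ∨ aᶜ ∈ u)

theorem cluster_aux_mono {B : Type*} [BooleanAlgebra B]
    {C : B → B → Prop} (hC : IsNormalContact C) {a b c d : B} (h : C a b)
    (hac : a ≤ c) (hbd : b ≤ d) : C c d := by
  obtain ⟨h1, h2, h3, h4, h5, h6⟩ := hC
  have e1 : C a d := by
    rw [← sup_eq_right.2 hbd]; exact (h4 _ _ _).2 (Or.inl h)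
  apply h3
  rw [← sup_eq_right.2 hac]; exact (h4 _ _ _).2 (Or.inl (h3 _ _ e1))

theorem cluster_aux_of_ultra {B : Type*} [BooleanAlgebra B]
    {C : B → B → Prop} (hC : IsNormalContact C) {u : Set B} (hu : IsBoolUltrafilter u) :
    IsCluster C {a : B | ∀ b ∈ u, C a b} := by
  obtain ⟨u1, u2, u3, u4⟩ := hu
  have mono := @cluster_aux_mono _ _ _ hC
  obtain ⟨h1, h2, h3, h4, h5, h6⟩ := hC
  have hsub : ∀ a ∈ u, ∀ b ∈ u, C a b := fun a ha b hb =>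
    mono (h1 (a ⊓ b) (fun h => u1 (h ▸ u2 a ha b hb))) inf_le_left inf_le_right
  refine ⟨⟨⊤, fun b hb => mono (hsub b hb b hb) le_top le_rfl⟩, ?_, ?_, ?_⟩
  · intro a ha b hb
    by_contra hn
    obtain ⟨c, hc1, hc2⟩ := h5 a b hn
    rcases u4 c with h | h
    · exact hc1 (ha c h)
    · exact hc2 (hb _ h)
  · intro a b hab
    by_contra hn
    simp only [Set.mem_setOf_eq, not_or, not_forall] at hn
    obtain ⟨⟨x, hx, hax⟩, y, hy, hby⟩ := hn
    rcases (h4 _ _ _).1 (h3 _ _ (hab _ (u2 x hx y hy))) with h | h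
    · exact hax (mono (h3 _ _ h) le_rfl inf_le_left)
    · exact hby (mono (h3 _ _ h) le_rfl inf_le_right)
  · intro a ha b hb
    exact ha b (hsub b hb)

theorem cluster_aux_ultra {B : Type*} [BooleanAlgebra B]
    {C : B → B → Prop} (hC : IsNormalContact C) {σ : Set B} (hσ : IsCluster C σ)
    {a₀ : B} (ha₀ : a₀ ∈ σ) :
    ∃ u : Set B, IsBoolUltrafilter u ∧ a₀ ∈ u ∧ σ = {a : B | ∀ b ∈ u, C a b} := by
  obtain ⟨-, s1, s2, s3⟩ := hσ
  have mono := @cluster_aux_mono _ _ _ hC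
  obtain ⟨h1, h2, h3, h4, h5, h6⟩ := hC
  have up : ∀ a ∈ σ, ∀ b, a ≤ b → b ∈ σ := fun a ha b hab =>
    s3 b fun c hc => mono (s1 a ha c hc) hab le_rfl
  have hbot : (⊥ : B) ∉ σ := fun h => (h2 _ _ (s1 _ h _ h)).1 rfl
  let I : Order.Ideal B :=
    { carrier := σᶜ
      lower' := fun a b hba ha hb => ha (up b hb a hba)
      nonempty' := ⟨⊥, hbot⟩
      directed' := fun a ha b hb =>
        ⟨a ⊔ b, fun h => (s2 a b h).elim ha hb, le_sup_left, le_sup_right⟩ }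
  have hd : Disjoint ((Order.PFilter.principal a₀ : Order.PFilter B) : Set B) (I : Set B) := by
    rw [Set.disjoint_left]
    intro x hx hxI
    exact hxI (up a₀ ha₀ x (Order.PFilter.mem_principal.1 hx))
  obtain ⟨J, hJ, hIJ, hdJ⟩ := DistribLattice.prime_ideal_of_disjoint_filter_ideal hd
  have hus : ∀ a, a ∉ J → a ∈ σ := fun a ha => by
    by_contra hn
    exact ha (hIJ hn)
  have ha₀J : a₀ ∉ J := fun h =>
    Set.disjoint_left.1 hdJ (Order.PFilter.mem_principal.2 le_rfl) h
  have hcompl : ∀ a, a ∉ J ∨ aᶜ ∉ J := fun a => by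
    by_contra hn
    push Not at hn
    have := Order.Ideal.sup_mem hn.1 hn.2
    rw [sup_compl_eq_top] at this
    exact ha₀J (J.lower le_top this)
  refine ⟨{a | a ∉ J}, ⟨fun h => h J.bot_mem, ?_, ?_, hcompl⟩, ha₀J, ?_⟩
  · intro a ha b hb h
    exact (hJ.mem_or_mem h).elim ha hb
  · intro a ha b hab hb
    exact ha (J.lower hab hb)
  · ext a
    refine ⟨fun ha b hb => s1 a ha b (hus b hb), fun ha => s3 a fun b hb => ?_⟩
    by_contra hn
    obtain ⟨c, hc1, hc2⟩ := h5 a b hn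
    rcases hcompl c with h | h
    · exact hc1 (ha c h)
    · exact hc2 (s1 b hb _ (hus _ h))

theorem cluster_iff_from_ultrafilter {B : Type*} [BooleanAlgebra B]
    (C : B → B → Prop) (hC : IsNormalContact C) :
    (∀ σ : Set B, IsCluster C σ ↔
      ∃ u : Set B, IsBoolUltrafilter u ∧ σ = {a : B | ∀ b ∈ u, C a b}) ∧
    (∀ σ : Set B, IsCluster C σ → ∀ a₀ ∈ σ,
      ∃ u : Set B, IsBoolUltrafilter u ∧ a₀ ∈ u ∧ σ = {a : B | ∀ b ∈ u, C a b}) := by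
  refine ⟨fun σ => ⟨fun h => ?_, ?_⟩, fun σ h a₀ ha₀ => cluster_aux_ultra hC h ha₀⟩
  · obtain ⟨a₀, ha₀⟩ := h.1
    obtain ⟨u, hu, -, e⟩ := cluster_aux_ultra hC h ha₀
    exact ⟨u, hu, e⟩
  · rintro ⟨u, hu, rfl⟩
    exact cluster_aux_of_ultra hC hu
end

section
/- Let (B, C) be a normal contact algebra and u an ultrafilter of B. Then σ_u = { a ∈ B | a C b for every b ∈ u } is the unique cluster of (B, C) containing u; that is, u ⊆ σ_u, σ_u is a cluster, and every cluster σ with u ⊆ σ satisfies σ = σ_u. -/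
theorem unique_cluster_containing_ultrafilter {B : Type*} [BooleanAlgebra B]
    (C : B → B → Prop) (hC : IsNormalContact C)
    (u : Set B) (hu : IsBoolUltrafilter u) :
    u ⊆ {a : B | ∀ b ∈ u, C a b} ∧
    IsCluster C {a : B | ∀ b ∈ u, C a b} ∧
    (∀ σ : Set B, IsCluster C σ → u ⊆ σ → σ = {a : B | ∀ b ∈ u, C a b}) := by
  obtain ⟨h1, h2, h3, h4, h5, -⟩ := hC
  obtain ⟨u0, ui, uu, uc⟩ := hu
  have mono : ∀ a b c, b ≤ c → C a b → C a c := by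
    intro a b c hbc hab
    have h := (h4 a b c).2 (Or.inl hab)
    rwa [sup_eq_right.2 hbc] at h
  have key : ∀ a b, (∀ x ∈ u, C a x) → (∀ x ∈ u, C b x) → C a b := by
    intro a b ha hb
    by_contra h
    obtain ⟨c, hc, hc'⟩ := h5 a b h
    rcases uc c with h | h
    · exact hc (ha _ h)
    · exact hc' (hb _ h)
  have sub : ∀ a ∈ u, ∀ b ∈ u, C a b := by
    intro a ha b hb
    have hne : a ⊓ b ≠ ⊥ := fun h => u0 (h ▸ ui a ha b hb)
    have e1 : C (a ⊓ b) b := mono _ _ _ inf_le_right (h1 _ hne)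
    exact h3 _ _ (mono _ _ _ inf_le_left (h3 _ _ e1))
  refine ⟨sub, ⟨?_, fun a ha b hb => key a b ha hb, ?_, fun a ha b hb => ha b (sub b hb)⟩, ?_⟩
  · rcases uc ⊤ with h | h
    · exact ⟨_, sub _ h⟩
    · exact ⟨_, sub _ h⟩
  · intro a b hab
    by_contra hcon
    simp only [Set.mem_setOf_eq, not_or, not_forall] at hcon
    obtain ⟨⟨x, hx, hax⟩, ⟨y, hy, hby⟩⟩ := hcon
    have h := h3 _ _ (hab (x ⊓ y) (ui x hx y hy))
    rcases (h4 _ _ _).1 h with h | h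
    · exact hax (mono _ _ _ inf_le_left (h3 _ _ h))
    · exact hby (mono _ _ _ inf_le_right (h3 _ _ h))
  · rintro σ ⟨-, s1, -, s3⟩ hus
    have hs : ∀ a ∈ σ, ∀ b ∈ u, C a b := fun a ha b hb => s1 a ha b (hus hb)
    exact Set.Subset.antisymm hs fun a ha => s3 a fun b hb => key a b ha (hs b hb)
end

section
/- A functor I : B ⥤ C between categories is fully left semi-adjoint if and only if I is full and faithful and there exist a functor E : C ⥤ B and a natural transformation π : E ⋙ I ⟶ 𝟭_C such that the component π_{I(B)} is an isomorphism for every object B of B. -/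
open CategoryTheory

/-- A functor `I : B ⥤ C` is *fully left semi-adjoint* if there are a functor
`E : C ⥤ B` and natural transformations `π : E ⋙ I ⟶ 𝟭 C` and
`σ : 𝟭 B ⟶ I ⋙ E` with `σ` a natural isomorphism, satisfying the triangular
identity `π_{I B} ∘ I(σ_B) = 𝟙 (I B)`. -/
def FullyLeftSemiAdjoint {B C : Type*} [Category B] [Category C] (I : B ⥤ C) : Prop :=
  ∃ (E : C ⥤ B) (π : E ⋙ I ⟶ 𝟭 C) (σ : 𝟭 B ⟶ I ⋙ E),
    IsIso σ ∧ ∀ b : B, I.map (σ.app b) ≫ π.app (I.obj b) = 𝟙 (I.obj b)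

theorem fullyLeftSemiAdjoint_iff {B C : Type*} [Category B] [Category C] (I : B ⥤ C) :
    FullyLeftSemiAdjoint I ↔
      (I.Full ∧ I.Faithful ∧
        ∃ (E : C ⥤ B) (π : E ⋙ I ⟶ 𝟭 C), ∀ b : B, IsIso (π.app (I.obj b))) := by
  constructor
  · rintro ⟨E, π, σ, hσ, tri⟩
    have hπ : ∀ b : B, π.app (I.obj b) = I.map (inv (σ.app b)) := fun b => by
      rw [← cancel_epi (I.map (σ.app b)), tri, ← I.map_comp, IsIso.hom_inv_id, I.map_id]
      rfl
    refine ⟨⟨?_⟩, ⟨?_⟩, E, π, fun b => ?_⟩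
    · intro X Y h
      refine ⟨σ.app X ≫ E.map h ≫ inv (σ.app Y), ?_⟩
      have n := π.naturality h
      have t := tri X
      dsimp at n t
      rw [I.map_comp, I.map_comp, ← hπ]
      erw [n]
      rw [← Category.assoc]
      erw [t]
      exact Category.id_comp h
    · intro X Y f g h
      have hf := σ.naturality f
      have hg := σ.naturality g
      dsimp at hf hg
      rw [h, ← hg] at hf
      exact (cancel_mono (σ.app Y)).1 hf
    · rw [hπ]
      infer_instance
  · rintro ⟨_, _, E, π, hπ⟩
    let e : ∀ b : B, (𝟭 B).obj b ≅ (I ⋙ E).obj b := fun b =>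
      I.preimageIso (asIso (π.app (I.obj b))).symm
    have he : ∀ b : B, I.map (e b).hom = inv (π.app (I.obj b)) := fun b => by
      simp [e]
    let s : 𝟭 B ≅ I ⋙ E := NatIso.ofComponents e (by
      intro X Y f
      apply I.map_injective
      rw [I.map_comp, I.map_comp, he, he, IsIso.eq_inv_comp, ← Category.assoc,
        IsIso.comp_inv_eq]
      exact (π.naturality (I.map f)).symm)
    refine ⟨E, π, s.hom, inferInstance, fun b => ?_⟩
    have : s.hom.app b = (e b).hom := rfl
    rw [this, he]
    exact IsIso.inv_hom_id _
end

section
/- Let I : B ⥤ C be a full and faithful functor, E : C ⥤ B a functor, π : E ⋙ I ⟶ 𝟭_C a natural transformation, and σ : 𝟭_B ⟶ I ⋙ E a natural isomorphism satisfying the triangular identity π_{I(B)} ∘ I(σ_B) = id_{I(B)} for every object B of B. Then the second triangular identity E(π_C) ∘ σ_{E(C)} = id_{E(C)} holds for every object C of C (so that σ and π exhibit I as left adjoint to E) if and only if I(E(π_C)) = π_{I(E(C))} for every object C of C. -/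
open CategoryTheory

theorem second_triangular_iff {B C : Type*} [Category B] [Category C]
    (I : B ⥤ C) (hIfull : I.Full) (hIfaithful : I.Faithful)
    (E : C ⥤ B) (π : E ⋙ I ⟶ 𝟭 C) (σ : 𝟭 B ⟶ I ⋙ E) (hσ : IsIso σ)
    (htri : ∀ b : B, I.map (σ.app b) ≫ π.app (I.obj b) = 𝟙 (I.obj b)) :
    (∀ c : C, σ.app (E.obj c) ≫ E.map (π.app c) = 𝟙 (E.obj c)) ↔
      (∀ c : C, I.map (E.map (π.app c)) = π.app (I.obj (E.obj c))) := by
  constructor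
  · intro h c
    have hiso : IsIso (σ.app (E.obj c)) := inferInstance
    have hI : IsIso (I.map (σ.app (E.obj c))) := inferInstance
    have h1 : I.map (σ.app (E.obj c)) ≫ I.map (E.map (π.app c)) = 𝟙 (I.obj (E.obj c)) :=
      (I.map_comp _ _).symm.trans ((congrArg I.map (h c)).trans (I.map_id _))
    exact hI.epi_of_iso.left_cancellation _ _ (h1.trans (htri (E.obj c)).symm)
  · intro h c
    apply I.map_injective
    refine (I.map_comp _ _).trans ?_
    refine (congrArg (fun f => I.map (σ.app (E.obj c)) ≫ f) (h c)).trans ?_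
    exact (htri (E.obj c)).trans (I.map_id _).symm
end

section
/- Let A, B, C be categories, I : B ⥤ C a full and faithful functor, E : C ⥤ B a functor, and π : E ⋙ I ⟶ 𝟭_C a natural transformation such that the component π_{I(B)} is an isomorphism for every object B of B; let T : Aᵒᵖ ⥤ B be an equivalence of categories. Then there exist a category D, a full and faithful functor J : A ⥤ D, a functor F : D ⥤ A with J ⋙ F = 𝟭_A, and an equivalence of categories T̃ : Dᵒᵖ ⥤ C such that Jᵒᵖ ⋙ T̃ = T ⋙ I and there is a natural isomorphism Fᵒᵖ ⋙ T ≅ T̃ ⋙ E. -/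
open CategoryTheory

universe v₁ v₂ v₃ u₁ u₂ u₃

namespace ExtDuality

/-- Objects of the extended category: objects of `A` and objects of `C`, side by side. -/
inductive DObj {A : Type u₁} {C : Type u₃} [Category.{v₃} C] (t : A → C) :
    Type (max u₁ u₃ v₃) where
  | inl (a : A) : DObj t
  | inr (c : C) : DObj t

variable {A : Type u₁} [Category.{v₁} A] {B : Type u₂} [Category.{v₂} B]
    {C : Type u₃} [Category.{v₃} C]

/-- The object of `C` underlying an object of the extended category. -/
def DObj.toC {t : A → C} : DObj t → C
  | .inl a => t a
  | .inr c => c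

/-- Morphisms are morphisms of `C`, reversed. -/
instance dCat (t : A → C) : Category.{max v₁ v₃} (DObj t) where
  Hom x y := ULift.{v₁} (y.toC ⟶ x.toC)
  id x := ⟨𝟙 _⟩
  comp f g := ⟨g.down ≫ f.down⟩

/-- The forgetful contravariant functor to `C`. -/
def tt (t : A → C) : (DObj t)ᵒᵖ ⥤ C where
  obj x := x.unop.toC
  map f := f.unop.down
  map_id _ := rfl
  map_comp _ _ := rfl

instance (t : A → C) : (tt t).Faithful where
  map_injective {x y f g} h := Quiver.Hom.unop_inj (ULift.ext _ _ h)

instance (t : A → C) : (tt t).Full where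
  map_surjective {x y} f :=
    ⟨Quiver.Hom.op (show y.unop ⟶ x.unop from ULift.up f), rfl⟩

instance (t : A → C) : (tt t).EssSurj where
  mem_essImage c := ⟨Opposite.op (.inr c), ⟨Iso.refl _⟩⟩

theorem tt_isEquivalence (t : A → C) : (tt t).IsEquivalence := {}

/-- The functor from `A`. -/
def jj (G : Aᵒᵖ ⥤ C) : A ⥤ DObj (fun a => G.obj (Opposite.op a)) where
  obj a := .inl a
  map f := ULift.up (G.map f.op)
  map_id a := ULift.ext _ _ (G.map_id _)
  map_comp f g := ULift.ext _ _ (G.map_comp _ _)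

/-- A functor to `A` from a pointwise family of isomorphisms. -/
noncomputable def ff {t : A → C} (E : C ⥤ B) (T : Aᵒᵖ ⥤ B) [T.Full] [T.Faithful]
    (o : DObj t → A) (φ : ∀ x, T.obj (Opposite.op (o x)) ≅ E.obj x.toC) : DObj t ⥤ A where
  obj := o
  map {x y} f := (T.preimage ((φ y).hom ≫ E.map f.down ≫ (φ x).inv)).unop
  map_id x := by
    apply Quiver.Hom.op_inj
    apply T.map_injective
    have : (φ x).hom ≫ E.map (𝟙 x.toC) ≫ (φ x).inv = 𝟙 _ := by simp
    exact (T.map_preimage _).trans (this.trans (T.map_id _).symm)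
  map_comp {x y z} f g := by
    apply Quiver.Hom.op_inj
    apply T.map_injective
    have : ULift.down (f ≫ g) = g.down ≫ f.down := rfl
    simp [this]

end ExtDuality

open ExtDuality in
theorem extension_of_duality
    {A : Type u₁} [Category.{v₁} A] {B : Type u₂} [Category.{v₂} B]
    {C : Type u₃} [Category.{v₃} C]
    (I : B ⥤ C) (hIfull : I.Full) (hIfaithful : I.Faithful)
    (E : C ⥤ B) (π : E ⋙ I ⟶ 𝟭 C)
    (hπ : ∀ b : B, IsIso (π.app (I.obj b)))
    (T : Aᵒᵖ ⥤ B) (hT : T.IsEquivalence) :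
    ∃ (D : Cat.{max v₁ v₃, max u₁ u₃ v₃}) (J : A ⥤ D) (F : D ⥤ A)
      (Tt : Dᵒᵖ ⥤ C),
      J.Full ∧ J.Faithful ∧ J ⋙ F = 𝟭 A ∧ Tt.IsEquivalence ∧
      J.op ⋙ Tt = T ⋙ I ∧ Nonempty (F.op ⋙ T ≅ Tt ⋙ E) := by
  let G : Aᵒᵖ ⥤ C := T ⋙ I
  let t : A → C := fun a => G.obj (Opposite.op a)
  let o : DObj t → A := fun x => match x with
    | .inl a => a
    | .inr c => (T.objPreimage (E.obj c)).unop
  let ψ : ∀ b : B, E.obj (I.obj b) ≅ b := fun b =>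
    I.preimageIso (asIso (π.app (I.obj b)))
  have hψ : ∀ {b b' : B} (f : b ⟶ b'), E.map (I.map f) ≫ (ψ b').hom = (ψ b).hom ≫ f := by
    intro b b' f
    apply I.map_injective
    simpa [ψ] using π.naturality (I.map f)
  let φ : ∀ x : DObj t, T.obj (Opposite.op (o x)) ≅ E.obj x.toC := fun x => match x with
    | .inl a => (ψ (T.obj (Opposite.op a))).symm
    | .inr c => T.objObjPreimageIso (E.obj c)
  refine ⟨Cat.of (DObj t), jj G, ff E T o φ, tt t, ⟨?_⟩, ⟨?_⟩, ?_, tt_isEquivalence t, rfl, ⟨?_⟩⟩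
  · intro a a' f
    obtain ⟨g, hg⟩ := G.map_surjective (show G.obj (Opposite.op a') ⟶ G.obj (Opposite.op a) from f.down)
    exact ⟨g.unop, ULift.ext _ _ hg⟩
  · intro a a' f g h
    apply Quiver.Hom.op_inj
    exact G.map_injective (congrArg ULift.down h)
  · refine CategoryTheory.Functor.ext (fun _ => rfl) ?_
    intro a a' f
    refine Eq.trans ?_ (show f = 𝟙 a ≫ f ≫ 𝟙 a' by simp)
    apply Quiver.Hom.op_inj
    apply T.map_injective
    change T.map (T.preimage ((ψ _).inv ≫ E.map (I.map (T.map f.op)) ≫ (ψ _).hom)) = T.map f.op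
    rw [T.map_preimage, hψ, Iso.inv_hom_id_assoc]
  · refine NatIso.ofComponents (fun x => φ x.unop) ?_
    intro x y f
    change T.map (T.preimage ((φ _).hom ≫ E.map f.unop.down ≫ (φ _).inv)) ≫ (φ _).hom
      = (φ _).hom ≫ E.map f.unop.down
    rw [T.map_preimage]
    simp
end

section
/- Let X and X' be compact Hausdorff spaces, EX and EX' extremally disconnected compact Hausdorff spaces, π : EX → X and π' : EX' → X' continuous irreducible surjections, f : X → X' a quasi-open continuous map, and f̂ : EX → EX' a continuous map with f ∘ π = π' ∘ f̂. Then for every regular closed set H' ⊆ X' one has cl(f⁻¹(int(H'))) = π( f̂⁻¹( cl( π'⁻¹( int(H') ) ) ) ). -/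
theorem closure_preimage_interior_eq
    {X X' EX EX' : Type*} [TopologicalSpace X] [TopologicalSpace X']
    [TopologicalSpace EX] [TopologicalSpace EX']
    [CompactSpace X] [T2Space X] [CompactSpace X'] [T2Space X']
    [CompactSpace EX] [T2Space EX] [ExtremallyDisconnected EX]
    [CompactSpace EX'] [T2Space EX'] [ExtremallyDisconnected EX']
    (π : EX → X) (π' : EX' → X') (hπ : Continuous π) (hπ' : Continuous π')
    (hiπ : IrreducibleMap π) (hiπ' : IrreducibleMap π')
    (f : X → X') (hf : Continuous f) (hq : QuasiOpen f)
    (fh : EX → EX') (hfh : Continuous fh) (hcomm : f ∘ π = π' ∘ fh) :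
    ∀ H' : Set X', H' = closure (interior H') →
      closure (f ⁻¹' interior H') = π '' (fh ⁻¹' closure (π' ⁻¹' interior H')) := by
  intro H' _
  have hc : ∀ e, f (π e) = π' (fh e) := fun e => congrFun hcomm e
  apply Set.Subset.antisymm
  · apply closure_minimal
    · intro x hx
      obtain ⟨e, rfl⟩ := hiπ.1 x
      refine ⟨e, subset_closure ?_, rfl⟩
      change π' (fh e) ∈ interior H'
      rw [← hc]
      exact hx
    · exact ((isClosed_closure.preimage hfh).isCompact.image hπ).isClosed
  · rintro _ ⟨e, he, rfl⟩
    by_contra hne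
    have hWo : IsOpen (closure (π' ⁻¹' interior H')) :=
      ExtremallyDisconnected.open_closure _ (isOpen_interior.preimage hπ')
    set G : Set EX := fh ⁻¹' closure (π' ⁻¹' interior H') ∩
      π ⁻¹' (closure (f ⁻¹' interior H'))ᶜ with hG
    have hGo : IsOpen G :=
      (hWo.preimage hfh).inter (isClosed_closure.isOpen_compl.preimage hπ)
    have heG : e ∈ G := ⟨he, hne⟩
    have hUo : IsOpen (π '' Gᶜ)ᶜ :=
      (hGo.isClosed_compl.isCompact.image hπ).isClosed.isOpen_compl
    have hUn : ((π '' Gᶜ)ᶜ).Nonempty := by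
      rw [Set.nonempty_compl]
      apply hiπ.2 _ hGo.isClosed_compl
      intro h
      have : e ∈ Gᶜ := h ▸ Set.mem_univ e
      exact this heG
    have hUG : ∀ u ∈ (π '' Gᶜ)ᶜ, ∃ g ∈ G, π g = u := by
      intro u hu
      obtain ⟨g, rfl⟩ := hiπ.1 u
      refine ⟨g, ?_, rfl⟩
      by_contra hg
      exact hu ⟨g, hg, rfl⟩
    obtain ⟨y, hy⟩ := hq _ hUo hUn
    have hyc : y ∈ closure (interior H') := by
      obtain ⟨u, hu, rfl⟩ := interior_subset hy
      obtain ⟨g, hg, rfl⟩ := hUG u hu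
      rw [hc]
      exact closure_mono (Set.image_preimage_subset _ _)
        (image_closure_subset_closure_image hπ' ⟨fh g, hg.1, rfl⟩)
    obtain ⟨z, hz, hzV⟩ := mem_closure_iff.1 hyc _ isOpen_interior hy
    obtain ⟨u, hu, rfl⟩ := interior_subset hz
    obtain ⟨g, hg, rfl⟩ := hUG u hu
    exact hg.2 (subset_closure hzV)
end

section
/- Let (B, C) be a contact algebra. Then for all a, b ∈ B: a C b if and only if there exist ultrafilters u and v of B with a ∈ u, b ∈ v, and c C d for all c ∈ u and d ∈ v. -/
/-- A binary relation on a Boolean algebra is a *contact relation* if it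
satisfies the axioms (C1)–(C4). -/
def IsContact {B : Type*} [BooleanAlgebra B] (C : B → B → Prop) : Prop :=
  (∀ a, a ≠ ⊥ → C a a) ∧
  (∀ a b, C a b → a ≠ ⊥ ∧ b ≠ ⊥) ∧
  (∀ a b, C a b → C b a) ∧
  (∀ a b c, C a (b ⊔ c) ↔ C a b ∨ C a c)

/-- An element outside an ideal lies in an ultrafilter disjoint from that ideal. -/
theorem exists_boolUltrafilter_of_notMem {B : Type*} [BooleanAlgebra B] (I : Set B)
    (h0 : ⊥ ∈ I) (hd : ∀ x ∈ I, ∀ y, y ≤ x → y ∈ I)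
    (hs : ∀ x ∈ I, ∀ y ∈ I, x ⊔ y ∈ I) (a : B) (ha : a ∉ I) :
    ∃ u : Set B, IsBoolUltrafilter u ∧ a ∈ u ∧ ∀ c ∈ u, c ∉ I := by
  let K : Order.Ideal B :=
    { carrier := I
      lower' := fun x y hyx hx => hd x hx y hyx
      nonempty' := ⟨⊥, h0⟩
      directed' := fun x hx y hy => ⟨x ⊔ y, hs x hx y hy, le_sup_left, le_sup_right⟩ }
  have hdisj : Disjoint (Order.PFilter.principal a : Set B) (K : Set B) := by
    rw [Set.disjoint_left]
    intro x hx hxI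
    exact ha (hd x hxI a (Order.PFilter.mem_principal.1 hx))
  obtain ⟨J, hJ, hKJ, hFJ⟩ :=
    DistribLattice.prime_ideal_of_disjoint_filter_ideal hdisj
  refine ⟨(J : Set B)ᶜ, ⟨?_, ?_, ?_, ?_⟩, ?_, ?_⟩
  · intro h
    exact h J.bot_mem
  · intro x hx y hy hxy
    exact (hJ.mem_or_mem hxy).elim hx hy
  · intro x hx y hxy hy
    exact hx (J.lower hxy hy)
  · intro x
    by_contra h
    simp only [Set.mem_compl_iff, SetLike.mem_coe, not_or, not_not] at h
    apply hJ.toIsProper.ne_top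
    apply Order.Ideal.top_of_top_mem
    have := J.sup_mem h.1 h.2
    rwa [sup_compl_eq_top] at this
  · exact Set.disjoint_left.1 hFJ (Order.PFilter.mem_principal.2 le_rfl)
  · intro c hc hcI
    exact hc (hKJ hcI)

theorem contact_iff_exists_ultrafilters {B : Type*} [BooleanAlgebra B]
    (C : B → B → Prop) (hC : IsContact C) :
    ∀ a b : B, C a b ↔
      ∃ u v : Set B, IsBoolUltrafilter u ∧ IsBoolUltrafilter v ∧
        a ∈ u ∧ b ∈ v ∧ ∀ c ∈ u, ∀ d ∈ v, C c d := by
  obtain ⟨-, h2, h3, h4⟩ := hC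
  have mono : ∀ x y z, C x y → y ≤ z → C x z := by
    intro x y z h hyz
    rw [← sup_eq_right.2 hyz]
    exact (h4 _ _ _).2 (Or.inl h)
  intro a b
  constructor
  · intro hab
    obtain ⟨u, hu, hau, huI⟩ := exists_boolUltrafilter_of_notMem {x | ¬ C b x}
      (fun h => (h2 _ _ h).2 rfl) (fun x hx y hyx h => hx (mono _ _ _ h hyx))
      (fun x hx y hy h => ((h4 _ _ _).1 h).elim hx hy) a (fun h => h (h3 _ _ hab))
    obtain ⟨v, hv, hbv, hvI⟩ := exists_boolUltrafilter_of_notMem {d | ∃ c ∈ u, ¬ C c d}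
      ⟨a, hau, fun h => (h2 _ _ h).2 rfl⟩
      (fun x ⟨c, hc, hx⟩ y hyx => ⟨c, hc, fun h => hx (mono _ _ _ h hyx)⟩)
      (fun x ⟨c, hc, hx⟩ y ⟨c', hc', hy⟩ => ⟨c ⊓ c', hu.2.1 c hc c' hc', fun h =>
        ((h4 _ _ _).1 h).elim
          (fun h => hx (h3 _ _ (mono _ _ _ (h3 _ _ h) inf_le_left)))
          (fun h => hy (h3 _ _ (mono _ _ _ (h3 _ _ h) inf_le_right)))⟩) b
      (fun ⟨c, hc, h⟩ => huI c hc (fun h' => h (h3 _ _ h')))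
    refine ⟨u, v, hu, hv, hau, hbv, fun c hc d hd => ?_⟩
    by_contra h
    exact hvI d hd ⟨c, hc, h⟩
  · rintro ⟨u, v, -, -, ha, hb, h⟩
    exact h a ha b hb
end

section
/- Let (B, C) be a normal contact algebra. Then the relation R on the set of ultrafilters of B, defined by u R v if and only if a C b for all a ∈ u and b ∈ v, is an equivalence relation. -/
theorem ultrafilter_contact_rel_equivalence {B : Type*} [BooleanAlgebra B]
    (C : B → B → Prop) (hC : IsNormalContact C) :
    Equivalence (fun u v : {u : Set B // IsBoolUltrafilter u} =>
      ∀ a ∈ u.1, ∀ b ∈ v.1, C a b) := by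
  obtain ⟨h1, _, h3, h4, h5, _⟩ := hC
  have mono : ∀ a b c, b ≤ c → C a b → C a c := by
    intro a b c hbc h
    have := (h4 a b c).2 (Or.inl h)
    rwa [sup_eq_right.2 hbc] at this
  refine ⟨?_, ?_, ?_⟩
  · rintro ⟨u, hu0, hu1, _, _⟩ a ha b hb
    have hne : a ⊓ b ≠ ⊥ := fun h => hu0 (h ▸ hu1 a ha b hb)
    exact mono _ _ _ inf_le_right (h3 _ _ (mono _ _ _ inf_le_left (h1 _ hne)))
  · intro u v h a ha b hb
    exact h3 _ _ (h b hb a ha)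
  · intro u v w huv hvw a ha b hb
    by_contra hab
    obtain ⟨c, hac, hbc⟩ := h5 a b hab
    rcases v.2.2.2.2 c with hc | hc
    · exact hac (huv a ha c hc)
    · exact hbc (h3 _ _ (hvw _ hc b hb))
end
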